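/- Let δ ≥ 0 be a real number. If G is a finite connected δ-hyperbolic graph, then γ_b(G) ≤ ⌊(3/2)·MP(G) + 2δ⌋, where γ_b(G) is the broadcast domination number and MP(G) is the multipacking number of G. -/

import Mathlib

open SimpleGraph

variable {V : Type*}

/-- The diameter of a graph: the supremum of distances between pairs of vertices. -/
noncomputable def gDiam (G : SimpleGraph V) : ℕ :=
  sSup (Set.range fun p : V × V => G.dist p.1 p.2)

/-- A multipacking of a graph `G` is a set `M` of vertices such that for every vertex `v`
and every integer `r ≥ 1`, the ball of radius `r` around `v` contains at most `r`
vertices of `M`. -/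
def IsMultipacking (G : SimpleGraph V) (M : Set V) : Prop :=
  ∀ v : V, ∀ r : ℕ, 1 ≤ r → (M ∩ {u | G.dist u v ≤ r}).ncard ≤ r

/-- The multipacking number of `G`: the maximum size of a multipacking. -/
noncomputable def multipackingNumber (G : SimpleGraph V) : ℕ :=
  sSup {n | ∃ M : Set V, IsMultipacking G M ∧ M.ncard = n}

/-- A dominating broadcast: a function `f : V → ℕ` bounded above by the diameter,
such that every vertex `u` is within distance `f v` of some vertex `v` with `f v > 0`. -/
def IsDominatingBroadcast (G : SimpleGraph V) (f : V → ℕ) : Prop :=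
  (∀ v : V, f v ≤ gDiam G) ∧ ∀ u : V, ∃ v : V, 0 < f v ∧ G.dist u v ≤ f v

/-- The broadcast domination number of `G`: the minimum cost of a dominating broadcast. -/
noncomputable def broadcastDominationNumber (G : SimpleGraph V) : ℕ :=
  sInf {c | ∃ f : V → ℕ, IsDominatingBroadcast G f ∧ ∑ᶠ v : V, f v = c}

/-- A graph is δ-hyperbolic if for any four vertices, the two larger of the three
pairwise distance sums differ by at most 2δ. -/
def IsHyperbolic (G : SimpleGraph V) (δ : ℝ) : Prop :=
  ∀ u v w x : V, ((G.dist u v + G.dist w x : ℕ) : ℝ) ≤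
    max ((G.dist u w + G.dist v x : ℕ) : ℝ) ((G.dist u x + G.dist v w : ℕ) : ℝ) + 2 * δ

/-- Any two vertices of a connected graph are joined by a geodesic. -/
theorem exists_geodesic (G : SimpleGraph V) (hconn : G.Connected) (u v : V) :
    ∃ p : ℕ → V, ∀ i ≤ G.dist u v, G.dist u (p i) = i ∧ G.dist (p i) v = G.dist u v - i := by
  obtain ⟨w, hw⟩ := hconn.exists_walk_length_eq_dist u v
  refine ⟨w.getVert, fun i hi => ?_⟩
  have h1 : G.dist u (w.getVert i) ≤ i :=
    (dist_le (w.take i)).trans (by rw [Walk.take_length]; exact min_le_left _ _)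
  have h2 : G.dist (w.getVert i) v ≤ G.dist u v - i :=
    (dist_le (w.drop i)).trans (by rw [Walk.drop_length, hw])
  have h3 := hconn.dist_triangle (u := u) (v := w.getVert i) (w := v)
  omega

/-- A set of naturals whose triples lie within `2 * r` of each other has at most `r` elements. -/
theorem card_le_of_three_mul_sub_le (K : Finset ℕ) (r : ℕ) (hr : 1 ≤ r)
    (hK : ∀ a ∈ K, ∀ b ∈ K, 3 * b ≤ 3 * a + 2 * r) : K.card ≤ r := by
  rcases K.eq_empty_or_nonempty with rfl | hne
  · simp
  · have hsub : K ⊆ Finset.Icc (K.min' hne) (K.min' hne + 2 * r / 3) := by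
      intro b hb
      have h1 := K.min'_le b hb
      have h2 := hK _ (K.min'_mem hne) b hb
      rw [Finset.mem_Icc]
      omega
    have h := Finset.card_le_card hsub
    rw [Nat.card_Icc] at h
    omega

theorem bddAbove_multipacking [Finite V] (G : SimpleGraph V) :
    BddAbove {n | ∃ M : Set V, IsMultipacking G M ∧ M.ncard = n} := by
  refine ⟨Nat.card V, ?_⟩
  rintro n ⟨M, -, rfl⟩
  exact Set.ncard_le_card M

/-- Every third vertex of a geodesic is a multipacking. -/
theorem dist_div_three_add_one_le_multipackingNumber [Finite V] (G : SimpleGraph V)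
    (hconn : G.Connected) (u v : V) : G.dist u v / 3 + 1 ≤ multipackingNumber G := by
  classical
  obtain ⟨p, hp⟩ := exists_geodesic G hconn u v
  refine le_csSup (bddAbove_multipacking G)
    ⟨(fun k => p (3 * k)) '' (Finset.range (G.dist u v / 3 + 1) : Set ℕ), ?_, ?_⟩
  · intro c r hr
    set K := (Finset.range (G.dist u v / 3 + 1)).filter (fun k => G.dist (p (3 * k)) c ≤ r)
      with hKdef
    have hcard : K.card ≤ r := by
      refine card_le_of_three_mul_sub_le K r hr fun a ha b hb => ?_
      simp only [hKdef, Finset.mem_filter, Finset.mem_range] at ha hb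
      have h1 := (hp (3 * a) (by omega)).1
      have h2 := (hp (3 * b) (by omega)).1
      have h3 := hconn.dist_triangle (u := u) (v := p (3 * a)) (w := p (3 * b))
      have h4 := hconn.dist_triangle (u := p (3 * a)) (v := c) (w := p (3 * b))
      rw [G.dist_comm (u := c)] at h4
      omega
    have hsub : ((fun k => p (3 * k)) '' (Finset.range (G.dist u v / 3 + 1) : Set ℕ)) ∩
        {x | G.dist x c ≤ r} ⊆ (fun k => p (3 * k)) '' (K : Set ℕ) := by
      rintro _ ⟨⟨k, hk, rfl⟩, hkc⟩
      exact ⟨k, by simpa [hKdef] using ⟨by simpa using hk, hkc⟩, rfl⟩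
    calc _ ≤ ((fun k => p (3 * k)) '' (K : Set ℕ)).ncard := Set.ncard_le_ncard hsub
      _ ≤ (K : Set ℕ).ncard := Set.ncard_image_le
      _ ≤ r := by rwa [Set.ncard_coe_finset]
  · rw [Set.InjOn.ncard_image, Set.ncard_coe_finset, Finset.card_range]
    intro a ha b hb hab
    simp only [Finset.coe_range, Set.mem_Iio] at ha hb
    have h1 := (hp (3 * a) (by omega)).1
    have h2 := (hp (3 * b) (by omega)).1
    simp only at hab
    rw [hab] at h1
    omega

theorem dist_le_gDiam [Finite V] (G : SimpleGraph V) (u v : V) : G.dist u v ≤ gDiam G :=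
  le_csSup (Set.finite_range _).bddAbove ⟨(u, v), rfl⟩

theorem exists_dist_eq_gDiam [Finite V] [Nonempty V] (G : SimpleGraph V) :
    ∃ u v : V, G.dist u v = gDiam G := by
  obtain ⟨⟨u, v⟩, h⟩ := Nat.sSup_mem (Set.range_nonempty fun p : V × V => G.dist p.1 p.2)
    (Set.finite_range _).bddAbove
  exact ⟨u, v, h⟩

/-- Broadcasting from a single vertex costs its eccentricity. -/
theorem exists_broadcastDominationNumber_le_dist [Finite V] (G : SimpleGraph V)
    (hconn : G.Connected) (c : V) :
    ∃ x, broadcastDominationNumber G ≤ G.dist c x := by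
  classical
  have : Nonempty V := ⟨c⟩
  obtain ⟨x, hx⟩ := Finite.exists_max (fun y => G.dist c y)
  by_cases h0 : gDiam G = 0
  · refine ⟨x, ?_⟩
    have hempty : {k | ∃ f : V → ℕ, IsDominatingBroadcast G f ∧ ∑ᶠ v : V, f v = k} = ∅ := by
      rw [Set.eq_empty_iff_forall_notMem]
      rintro k ⟨f, ⟨hf, hdom⟩, -⟩
      obtain ⟨v, hv, -⟩ := hdom c
      have := hf v
      omega
    simp [broadcastDominationNumber, hempty]
  · refine ⟨x, Nat.sInf_le ⟨Pi.single c (G.dist c x), ⟨fun v => ?_, fun u => ⟨c, ?_, ?_⟩⟩, ?_⟩⟩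
    · by_cases hv : v = c
      · subst hv
        simpa using dist_le_gDiam G v x
      · simp [hv]
    · obtain ⟨a, b, hab⟩ := exists_dist_eq_gDiam G
      have h1 := hconn.dist_triangle (u := a) (v := c) (w := b)
      have h2 := hx a
      have h3 := hx b
      rw [G.dist_comm (u := a) (v := c)] at h1
      rw [Pi.single_eq_same]
      omega
    · simpa [G.dist_comm (u := u)] using hx u
    · rw [finsum_eq_single _ c (fun v hv => by simp [hv])]
      simp

/-- In a hyperbolic graph some vertex has eccentricity about half the diameter. -/
theorem IsHyperbolic.exists_center [Finite V] {G : SimpleGraph V} (hconn : G.Connected) {δ : ℝ}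
    (hhyp : IsHyperbolic G δ) :
    ∃ c, ∀ x, (G.dist c x : ℝ) ≤ ((gDiam G : ℝ) + 1) / 2 + 2 * δ := by
  have := hconn.nonempty
  obtain ⟨u, v, huv⟩ := exists_dist_eq_gDiam G
  obtain ⟨p, hp⟩ := exists_geodesic G hconn u v
  obtain ⟨h1, h2⟩ := hp (G.dist u v / 2) (by omega)
  refine ⟨p (G.dist u v / 2), fun x => ?_⟩
  set c := p (G.dist u v / 2)
  have h := hhyp u v c x
  have hxu := dist_le_gDiam G u x
  have hxv := dist_le_gDiam G v x
  rw [G.dist_comm (u := c)] at h2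
  have hcu : 2 * G.dist u c ≤ gDiam G + 1 := by omega
  have hcv : 2 * G.dist v c ≤ gDiam G + 1 := by omega
  rw [huv] at h
  push_cast at h
  rify at hxu hxv hcu hcv
  rcases max_cases ((G.dist u c : ℝ) + G.dist v x) ((G.dist u x : ℝ) + G.dist v c) with hm | hm
    <;> linarith [hm.1]

/-- If G is a finite connected δ-hyperbolic graph (δ ≥ 0),
then γ_b(G) ≤ ⌊(3/2)·MP(G) + 2δ⌋. -/
theorem stmt6 {V : Type*} [Fintype V] (G : SimpleGraph V) (hconn : G.Connected)
    (δ : ℝ) (hδ : 0 ≤ δ) (hhyp : IsHyperbolic G δ) :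
    (broadcastDominationNumber G : ℤ) ≤
      ⌊(3 / 2 : ℝ) * multipackingNumber G + 2 * δ⌋ := by
  obtain ⟨c, hc⟩ := hhyp.exists_center hconn
  obtain ⟨x, hx⟩ := exists_broadcastDominationNumber_le_dist G hconn c
  have := hconn.nonempty
  obtain ⟨u, v, huv⟩ := exists_dist_eq_gDiam G
  have hM := dist_div_three_add_one_le_multipackingNumber G hconn u v
  have hM' : gDiam G + 1 ≤ 3 * multipackingNumber G := by omega
  rw [Int.le_floor]
  have h := hc x
  rify at hM' hx
  push_cast
  linarith
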